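/- For every β > 0, A^{−β} = (sin(πβ)/π) ∫_r^R t^{−β} (t·I + A)^{−1} dt + (R^{1−β}/(2π)) ∫_{−π}^{π} e^{i(1−β)θ} (R e^{iθ}·I − A)^{−1} dθ − (r^{1−β}/(2π)) ∫_{−π}^{π} e^{i(1−β)θ} (r e^{iθ}·I − A)^{−1} dθ. (This explicit three-term Dunford–Taylor representation of the inverse fractional power, obtained as the ω → π limit of a keyhole contour, is the representation formula underlying the paper's perturbation analysis.) -/

import Mathlib

open ComplexInnerProductSpace intervalIntegral

open Complex Set in
/-- The boundary integral over a rectangle of height `2π` vanishes for a quotient with denominator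
`exp w - a` whose numerator vanishes at the only zero `log a` of the denominator. -/
lemma integral_boundary_rect_div_exp_sub_eq_zero {N : ℂ → ℂ} (hN : Differentiable ℂ N)
    {a x₁ x₂ : ℝ} (ha : 0 < a) (hNa : N (Real.log a) = 0)
    (h₁ : Real.log a ≠ x₁) (h₂ : Real.log a ≠ x₂) :
    (((∫ x : ℝ in x₁..x₂, N (x - Real.pi * I) / (exp (x - Real.pi * I) - a)) -
        ∫ x : ℝ in x₁..x₂, N (x + Real.pi * I) / (exp (x + Real.pi * I) - a)) +
        I * ∫ y : ℝ in (-Real.pi)..Real.pi, N (x₂ + y * I) / (exp (x₂ + y * I) - a)) -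
        I * ∫ y : ℝ in (-Real.pi)..Real.pi, N (x₁ + y * I) / (exp (x₁ + y * I) - a) = 0 := by
  have hVL : exp ((Real.log a : ℝ) : ℂ) - a = 0 := by
    rw [← ofReal_exp, Real.exp_log ha, sub_self]
  have hV : Differentiable ℂ (fun w : ℂ => exp w - a) := by fun_prop
  have hslope : ∀ {f : ℂ → ℂ}, Differentiable ℂ f →
      Differentiable ℂ (dslope f ((Real.log a : ℝ) : ℂ)) := by
    intro f hf
    rw [← differentiableOn_univ] at hf ⊢
    exact (differentiableOn_dslope Filter.univ_mem).2 hf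
  have hzero : ∀ w : ℂ, w.im ∈ Icc (-Real.pi) Real.pi → exp w - a = 0 →
      w = ((Real.log a : ℝ) : ℂ) := by
    intro w hw h
    rw [← hVL, sub_left_inj, exp_eq_exp_iff_exists_int] at h
    obtain ⟨n, hn⟩ := h
    have him : w.im = n * (2 * Real.pi) := by
      rw [hn]; simp
    rw [him] at hw
    have hpi := Real.pi_pos
    have hn1 : (n : ℝ) < 1 := by
      by_contra! hc
      nlinarith [hw.2]
    have hn2 : (-1 : ℝ) < n := by
      by_contra! hc
      nlinarith [hw.1]
    have hn0 : n = 0 := by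
      have h1 : n < 1 := by exact_mod_cast hn1
      have h2 : -1 < n := by exact_mod_cast hn2
      omega
    rw [hn, hn0]; simp
  have key := integral_boundary_rect_eq_zero_of_differentiableOn
    (fun w => dslope N ((Real.log a : ℝ) : ℂ) w /
      dslope (fun w : ℂ => exp w - a) ((Real.log a : ℝ) : ℂ) w) ⟨x₁, -Real.pi⟩ ⟨x₂, Real.pi⟩ (by
    refine (hslope hN).differentiableOn.div (hslope hV).differentiableOn ?_
    intro w hw
    have hwim : w.im ∈ Icc (-Real.pi) Real.pi := by
      have := hw.2
      rwa [mem_preimage, uIcc_of_le (by linarith [Real.pi_pos])] at this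
    by_cases hwL : w = ((Real.log a : ℝ) : ℂ)
    · rw [hwL, dslope_same]
      simp [exp_ne_zero]
    · rw [dslope_of_ne _ hwL, slope_def_field, hVL, sub_zero]
      exact div_ne_zero (fun h => hwL (hzero w hwim h)) (sub_ne_zero.2 hwL))
  have hquot : ∀ w : ℂ, w ≠ ((Real.log a : ℝ) : ℂ) →
      dslope N ((Real.log a : ℝ) : ℂ) w /
        dslope (fun w : ℂ => exp w - a) ((Real.log a : ℝ) : ℂ) w = N w / (exp w - a) := by
    intro w hw
    have := sub_ne_zero.2 hw
    rw [dslope_of_ne _ hw, dslope_of_ne _ hw, slope_def_field, slope_def_field, hVL, hNa, sub_zero,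
      sub_zero, div_div_div_cancel_right₀ this]
  have hpi := Real.pi_ne_zero
  have e1 : ∀ x : ℝ, (x : ℂ) + ((-Real.pi : ℝ) : ℂ) * I ≠ ((Real.log a : ℝ) : ℂ) := by
    intro x h
    have := congrArg im h
    simp at this
  have e2 : ∀ x : ℝ, (x : ℂ) + ((Real.pi : ℝ) : ℂ) * I ≠ ((Real.log a : ℝ) : ℂ) := by
    intro x h
    have := congrArg im h
    simp at this
  have e3 : ∀ x : ℝ, Real.log a ≠ x → ∀ y : ℝ, (x : ℂ) + y * I ≠ ((Real.log a : ℝ) : ℂ) := by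
    intro x hx y h
    have := congrArg re h
    simp at this
    exact hx this.symm
  simp only [hquot _ (e1 _), hquot _ (e2 _), hquot _ (e3 _ h₁ _), hquot _ (e3 _ h₂ _),
    smul_eq_mul] at key
  simpa only [ofReal_neg, neg_mul, ← sub_eq_add_neg] using key

open Complex in
/-- A circle integral around the origin, written over the symmetric parameter interval. -/
lemma integral_mul_exp_div_sub_eq (ρ : ℝ) (a : ℂ) :
    I * ∫ θ : ℝ in (-Real.pi)..Real.pi, ρ * exp (θ * I) / (ρ * exp (θ * I) - a) =
      ∮ z in C(0, ρ), (z - a)⁻¹ := by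
  have hper : Function.Periodic
      (fun θ : ℝ => (ρ : ℂ) * exp (θ * I) / (ρ * exp (θ * I) - a)) (2 * Real.pi) := by
    intro θ
    have : exp (((θ + 2 * Real.pi : ℝ) : ℂ) * I) = exp (θ * I) := by
      push_cast
      rw [add_mul, exp_add, exp_two_pi_mul_I, mul_one]
    simp only [this]
  have h := hper.intervalIntegral_add_eq (-Real.pi) 0
  rw [show -Real.pi + 2 * Real.pi = Real.pi by ring, zero_add] at h
  rw [h, circleIntegral, ← intervalIntegral.integral_const_mul]
  refine intervalIntegral.integral_congr fun θ _ => ?_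
  simp only [deriv_circleMap, circleMap, zero_add, smul_eq_mul]
  ring

open Complex in
lemma circleIntegral_sub_inv_of_lt_norm {ρ : ℝ} (hρ : 0 ≤ ρ) {a : ℂ} (ha : ρ < ‖a‖) :
    ∮ z in C(0, ρ), (z - a)⁻¹ = 0 := by
  have hne : ∀ z ∈ Metric.closedBall (0 : ℂ) ρ, z - a ≠ 0 := by
    intro z hz h
    rw [mem_closedBall_zero_iff, sub_eq_zero.1 h] at hz
    linarith
  refine circleIntegral_eq_zero_of_differentiable_on_off_countable hρ Set.countable_empty ?_ ?_
  · exact ContinuousOn.inv₀ (by fun_prop) hne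
  · intro z hz
    exact DifferentiableAt.inv (by fun_prop) (hne z (Metric.ball_subset_closedBall hz.1))

lemma integral_exp_mul_div_exp_add {r R : ℝ} (hr : 0 < r) (hR : 0 < R) {a : ℝ} (ha : 0 < a)
    (β : ℝ) :
    ∫ x : ℝ in Real.log r..Real.log R, Real.exp ((1 - β) * x) / (Real.exp x + a) =
      ∫ t : ℝ in r..R, t ^ (-β) / (t + a) := by
  have h := intervalIntegral.integral_deriv_smul_comp'' (a := Real.log r) (b := Real.log R)
    (f := Real.exp) (f' := Real.exp) (g := fun t : ℝ => t ^ (-β) / (t + a))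
    Real.continuous_exp.continuousOn
    (fun x _ => (Real.hasDerivAt_exp x).hasDerivWithinAt) Real.continuous_exp.continuousOn (by
      rintro _ ⟨x, -, rfl⟩
      have := Real.exp_pos x
      have h1 : Real.exp x + a ≠ 0 := by positivity
      exact ((Real.continuousAt_rpow_const _ _ (Or.inl this.ne')).div (by fun_prop)
        h1).continuousWithinAt)
  rw [Real.exp_log hr, Real.exp_log hR] at h
  rw [← h]
  refine intervalIntegral.integral_congr fun x _ => ?_
  simp only [Function.comp, smul_eq_mul]
  rw [← Real.exp_mul, ← mul_div_assoc, ← Real.exp_add]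
  ring_nf

open Complex in
/-- The scalar keyhole-contour formula for `a ^ (-β)`. -/
lemma rpow_neg_eq_keyhole {r R a : ℝ} (hr : 0 < r) (hra : r < a) (haR : a < R) (β : ℝ) :
    ((a ^ (-β) : ℝ) : ℂ) =
      ((Real.sin (Real.pi * β) / Real.pi : ℝ) : ℂ) *
        (∫ t : ℝ in r..R, ((t ^ (-β) : ℝ) : ℂ) * ((t : ℂ) + a)⁻¹)
      + ((R ^ (1 - β) / (2 * Real.pi) : ℝ) : ℂ) *
        (∫ θ : ℝ in (-Real.pi)..Real.pi,
          exp (I * ((1 - β : ℝ) : ℂ) * θ) * (R * exp (I * θ) - a)⁻¹)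
      - ((r ^ (1 - β) / (2 * Real.pi) : ℝ) : ℂ) *
        (∫ θ : ℝ in (-Real.pi)..Real.pi,
          exp (I * ((1 - β : ℝ) : ℂ) * θ) * (r * exp (I * θ) - a)⁻¹) := by
  have ha : 0 < a := hr.trans hra
  have hR : 0 < R := ha.trans haR
  set C : ℂ := ((a ^ (-β) : ℝ) : ℂ) with hC
  have hden : ∀ ρ : ℝ, 0 < ρ → ρ ≠ a → ∀ θ : ℝ, (ρ : ℂ) * exp (θ * I) - a ≠ 0 := by
    intro ρ hρ hρa θ h
    have := congrArg norm (sub_eq_zero.1 h)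
    rw [norm_mul, norm_exp_ofReal_mul_I, mul_one, norm_real, norm_real, Real.norm_of_nonneg hρ.le,
      Real.norm_of_nonneg ha.le] at this
    exact hρa this
  have hvert : ∀ ρ : ℝ, 0 < ρ → ρ ≠ a →
      I * ∫ y : ℝ in (-Real.pi)..Real.pi,
        (exp ((1 - β : ℝ) * (Real.log ρ + y * I)) - C * exp (Real.log ρ + y * I)) /
          (exp (Real.log ρ + y * I) - a) =
      I * (((ρ ^ (1 - β) : ℝ) : ℂ) * ∫ θ : ℝ in (-Real.pi)..Real.pi,
          exp (I * ((1 - β : ℝ) : ℂ) * θ) * (ρ * exp (I * θ) - a)⁻¹) -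
        C * ∮ z in C(0, ρ), (z - a)⁻¹ := by
    intro ρ hρ hρa
    rw [← integral_mul_exp_div_sub_eq, mul_left_comm C I, ← mul_sub]
    congr 1
    rw [← intervalIntegral.integral_const_mul, ← intervalIntegral.integral_const_mul,
      ← intervalIntegral.integral_sub]
    · refine intervalIntegral.integral_congr fun θ _ => ?_
      have h1 : exp (Real.log ρ + θ * I) = ρ * exp (θ * I) := by
        rw [exp_add, ← ofReal_exp, Real.exp_log hρ]
      have h2 : exp ((1 - β : ℝ) * (Real.log ρ + θ * I)) =
          ((ρ ^ (1 - β) : ℝ) : ℂ) * exp (I * ((1 - β : ℝ) : ℂ) * θ) := by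
        rw [Real.rpow_def_of_pos hρ, ofReal_exp, ← exp_add]
        congr 1
        push_cast
        ring
      simp only [h1, h2, mul_comm I (θ : ℂ)]
      ring
    · refine Continuous.intervalIntegrable ?_ _ _
      refine continuous_const.mul (Continuous.mul (by fun_prop) (Continuous.inv₀ (by fun_prop) ?_))
      intro θ
      rw [mul_comm I]
      exact hden ρ hρ hρa θ
    · refine Continuous.intervalIntegrable ?_ _ _
      exact continuous_const.mul (Continuous.div (by fun_prop) (by fun_prop) (hden ρ hρ hρa))
  have hexpm : ∀ x : ℝ, exp (x - Real.pi * I) = -exp x := by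
    intro x; rw [exp_sub, exp_pi_mul_I, div_neg, div_one]
  have hexpp : ∀ x : ℝ, exp (x + Real.pi * I) = -exp x := by
    intro x; rw [exp_add, exp_pi_mul_I, mul_neg, mul_one]
  have hden' : ∀ x : ℝ, -exp (x : ℂ) - a ≠ 0 := by
    intro x h
    have h0 : -Real.exp x - a = 0 := by exact_mod_cast h
    linarith [Real.exp_pos x]
  have hhor :
      (∫ x : ℝ in Real.log r..Real.log R,
        (exp ((1 - β : ℝ) * (x - Real.pi * I)) - C * exp (x - Real.pi * I)) /
          (exp (x - Real.pi * I) - a)) -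
      (∫ x : ℝ in Real.log r..Real.log R,
        (exp ((1 - β : ℝ) * (x + Real.pi * I)) - C * exp (x + Real.pi * I)) /
          (exp (x + Real.pi * I) - a)) =
      2 * I * ((Real.sin (Real.pi * β) : ℝ) : ℂ) *
        ∫ t : ℝ in r..R, ((t ^ (-β) : ℝ) : ℂ) * ((t : ℂ) + a)⁻¹ := by
    have hI : (∫ t : ℝ in r..R, ((t ^ (-β) : ℝ) : ℂ) * ((t : ℂ) + a)⁻¹) =
        ∫ x : ℝ in Real.log r..Real.log R, exp ((1 - β : ℝ) * x) / (exp x + a) := by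
      have := congrArg ofReal (integral_exp_mul_div_exp_add hr hR ha β)
      rw [← intervalIntegral.integral_ofReal, ← intervalIntegral.integral_ofReal] at this
      simpa only [ofReal_div, ofReal_add, ofReal_exp, ofReal_mul, ofReal_inv, div_eq_mul_inv]
        using this.symm
    rw [hI, ← intervalIntegral.integral_const_mul, ← intervalIntegral.integral_sub]
    · refine intervalIntegral.integral_congr fun x _ => ?_
      have hs : 2 * I * ((Real.sin (Real.pi * β) : ℝ) : ℂ) =
          exp ((1 - β : ℝ) * (Real.pi * I)) - exp (-((1 - β : ℝ) * (Real.pi * I))) := by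
        rw [show Real.sin (Real.pi * β) = Real.sin ((1 - β) * Real.pi) by
          rw [← Real.sin_pi_sub]; ring_nf, ofReal_sin, Complex.sin]
        rw [show ((((1 - β) * Real.pi : ℝ) : ℂ)) * I = (1 - β : ℝ) * (Real.pi * I) by
          push_cast; ring, show -((((1 - β) * Real.pi : ℝ) : ℂ)) * I =
            -((1 - β : ℝ) * (Real.pi * I)) by push_cast; ring]
        linear_combination (exp (-((1 - β : ℝ) * (Real.pi * I))) -
          exp ((1 - β : ℝ) * (Real.pi * I))) * I_mul_I
      have hd := hden' x
      have hd2 : exp (x : ℂ) + a ≠ 0 := by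
        intro h
        exact hd (by linear_combination -h)
      simp only [hs, hexpm, hexpp]
      rw [mul_sub, mul_add, sub_eq_add_neg ((1 - β : ℝ) * (x : ℂ)), exp_add, exp_add,
        show -exp (x : ℂ) - a = -(exp (x : ℂ) + a) by ring]
      field_simp
      ring
    · refine Continuous.intervalIntegrable (Continuous.div (by fun_prop) (by fun_prop) ?_) _ _
      intro x; rw [hexpm]; exact hden' x
    · refine Continuous.intervalIntegrable (Continuous.div (by fun_prop) (by fun_prop) ?_) _ _
      intro x; rw [hexpp]; exact hden' x
  have key := integral_boundary_rect_div_exp_sub_eq_zero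
    (N := fun w => exp ((1 - β : ℝ) * w) - C * exp w) (by fun_prop) (x₁ := Real.log r)
    (x₂ := Real.log R) ha (by
      rw [hC, Real.rpow_def_of_pos ha, ofReal_exp, ← exp_add, sub_eq_zero]
      congr 1
      push_cast
      ring)
    (Real.log_lt_log hr hra).ne' (Real.log_lt_log ha haR).ne
  rw [hhor, hvert R hR haR.ne', hvert r hr hra.ne,
    circleIntegral.integral_sub_inv_of_mem_ball (by
      rwa [mem_ball_zero_iff, norm_real, Real.norm_of_nonneg ha.le]),
    circleIntegral_sub_inv_of_lt_norm hr.le (by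
      rwa [norm_real, Real.norm_of_nonneg ha.le])] at key
  have hpi : (Real.pi : ℂ) ≠ 0 := ofReal_ne_zero.2 Real.pi_ne_zero
  have h2 : (2 * Real.pi * I : ℂ) ≠ 0 := mul_ne_zero (mul_ne_zero two_ne_zero hpi) I_ne_zero
  apply mul_left_cancel₀ h2
  generalize (∫ t : ℝ in r..R, ((t ^ (-β) : ℝ) : ℂ) * ((t : ℂ) + a)⁻¹) = J₀ at key ⊢
  generalize (∫ θ : ℝ in (-Real.pi)..Real.pi,
    exp (I * ((1 - β : ℝ) : ℂ) * θ) * (R * exp (I * θ) - a)⁻¹) = J₁ at key ⊢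
  generalize (∫ θ : ℝ in (-Real.pi)..Real.pi,
    exp (I * ((1 - β : ℝ) : ℂ) * θ) * (r * exp (I * θ) - a)⁻¹) = J₂ at key ⊢
  push_cast at key ⊢
  field_simp
  apply mul_left_cancel₀ I_ne_zero
  linear_combination -key

/-- An operator integral of weighted inverses acts on a common eigenvector by the corresponding
scalar integral. -/
lemma integral_smul_ringInverse_apply {E : Type*} [NormedAddCommGroup E] [NormedSpace ℂ E]
    [CompleteSpace E] {a b : ℝ} {c k : ℝ → ℂ} {B : ℝ → E →L[ℂ] E}
    (hc : ContinuousOn c (Set.uIcc a b)) (hB : Continuous B)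
    (hunit : ∀ t ∈ Set.uIcc a b, IsUnit (B t)) {v : E} (hv : v ≠ 0)
    (hBv : ∀ t, B t v = k t • v) :
    (∫ t in a..b, c t • Ring.inverse (B t)) v = (∫ t in a..b, c t * (k t)⁻¹) • v := by
  have hcont : ContinuousOn (fun t => c t • Ring.inverse (B t)) (Set.uIcc a b) := by
    refine hc.smul fun t ht => ?_
    obtain ⟨u, hu⟩ := hunit t ht
    have h := NormedRing.inverse_continuousAt u
    rw [hu] at h
    exact (ContinuousAt.comp (f := B) h hB.continuousAt).continuousWithinAt
  rw [ContinuousLinearMap.intervalIntegral_apply hcont.intervalIntegrable,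
    ← intervalIntegral.integral_smul_const]
  refine intervalIntegral.integral_congr fun t ht => ?_
  have hinv : k t • Ring.inverse (B t) v = v := by
    have h := congrArg (fun T : E →L[ℂ] E => T v) (Ring.inverse_mul_cancel (B t) (hunit t ht))
    simpa [hBv] using h
  have hk : k t ≠ 0 := by
    intro h
    rw [h, zero_smul] at hinv
    exact hv hinv.symm
  simp only [smul_apply, mul_smul]
  rw [eq_inv_smul_iff₀ hk |>.2 hinv]

/-- Explicit three-term Dunford–Taylor representation of the inverse
fractional power.  `E` is a nontrivial finite-dimensional complex Hilbert space, `A`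
a selfadjoint operator with spectrum in the open interval `(r, R) ⊆ (0, ∞)`, and
`A^{−β}` (characterized on eigenvectors by `μ ↦ μ^{−β}`) the functional calculus of
`λ ↦ λ^{−β}`.  Then for every `β > 0`:
`A^{−β} = (sin(πβ)/π) ∫_r^R t^{−β} (tI + A)^{−1} dt
  + (R^{1−β}/(2π)) ∫_{−π}^{π} e^{i(1−β)θ} (R e^{iθ} I − A)^{−1} dθ
  − (r^{1−β}/(2π)) ∫_{−π}^{π} e^{i(1−β)θ} (r e^{iθ} I − A)^{−1} dθ`,
where the integrals are Bochner integrals of operator-valued functions and the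
inverses are taken in the ring of continuous linear operators on `E` (they exist for
all parameter values by the assumption on the spectrum). -/
theorem stmt12
    {E : Type*} [NormedAddCommGroup E] [InnerProductSpace ℂ E]
    [FiniteDimensional ℂ E] [Nontrivial E]
    (A : E →L[ℂ] E)
    (hA : ∀ x y : E, ⟪A x, y⟫ = ⟪x, A y⟫)
    (r R : ℝ) (hr : 0 < r) (hrR : r < R)
    (hspec : spectrum ℂ A ⊆ Complex.ofReal '' Set.Ioo r R)
    (β : ℝ) (hβ : 0 < β)
    (Anegβ : E →L[ℂ] E)
    (hAnegβ : ∀ (μ : ℝ) (x : E), A x = (μ : ℂ) • x → Anegβ x = ((μ ^ (-β) : ℝ) : ℂ) • x) :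
    Anegβ =
      ((Real.sin (Real.pi * β) / Real.pi : ℝ) : ℂ) •
        (∫ t in r..R, ((t ^ (-β) : ℝ) : ℂ) •
          Ring.inverse ((t : ℂ) • (1 : E →L[ℂ] E) + A))
      + ((R ^ (1 - β) / (2 * Real.pi) : ℝ) : ℂ) •
        (∫ θ in (-Real.pi)..Real.pi,
          Complex.exp (Complex.I * ((1 - β : ℝ) : ℂ) * (θ : ℂ)) •
            Ring.inverse (((R : ℂ) * Complex.exp (Complex.I * (θ : ℂ))) •
              (1 : E →L[ℂ] E) - A))
      - ((r ^ (1 - β) / (2 * Real.pi) : ℝ) : ℂ) •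
        (∫ θ in (-Real.pi)..Real.pi,
          Complex.exp (Complex.I * ((1 - β : ℝ) : ℂ) * (θ : ℂ)) •
            Ring.inverse (((r : ℂ) * Complex.exp (Complex.I * (θ : ℂ))) •
              (1 : E →L[ℂ] E) - A)) := by
  have hunit : ∀ z : ℂ, (∀ μ ∈ Set.Ioo r R, z ≠ (μ : ℂ)) →
      IsUnit (z • (1 : E →L[ℂ] E) - A) := by
    intro z hz
    by_contra h
    rw [← Algebra.algebraMap_eq_smul_one, ← spectrum.mem_iff] at h
    obtain ⟨μ, hμ, rfl⟩ := hspec h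
    exact hz μ hμ rfl
  have hcirc : ∀ ρ : ℝ, 0 < ρ → ρ ∉ Set.Ioo r R → ∀ θ : ℝ,
      IsUnit (((ρ : ℂ) * Complex.exp (Complex.I * (θ : ℂ))) • (1 : E →L[ℂ] E) - A) := by
    intro ρ hρ hρI θ
    refine hunit _ fun μ hμ h => hρI ?_
    have hn := congrArg norm h
    rw [norm_mul, mul_comm Complex.I, Complex.norm_exp_ofReal_mul_I, mul_one, Complex.norm_real,
      Complex.norm_real, Real.norm_of_nonneg hρ.le, Real.norm_of_nonneg (hr.trans hμ.1).le] at hn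
    rwa [hn]
  have hpos : ∀ t ∈ Set.uIcc r R, 0 < t := by
    intro t ht
    rw [Set.uIcc_of_le hrR.le] at ht
    exact hr.trans_le ht.1
  have hray : ∀ t ∈ Set.uIcc r R, IsUnit ((t : ℂ) • (1 : E →L[ℂ] E) + A) := by
    intro t ht
    have h := hunit (-(t : ℂ)) fun μ hμ h => by
      have h' : -t = μ := by exact_mod_cast h
      linarith [hpos t ht, hμ.1]
    rw [show (t : ℂ) • (1 : E →L[ℂ] E) + A = -((-(t : ℂ)) • (1 : E →L[ℂ] E) - A) by
      rw [neg_smul]; abel]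
    exact h.neg
  have hsymm : (A : E →ₗ[ℂ] E).IsSymmetric := hA
  refine ContinuousLinearMap.coe_injective
    ((hsymm.eigenvectorBasis rfl).toBasis.ext fun i => ?_)
  rw [OrthonormalBasis.coe_toBasis]
  set v := hsymm.eigenvectorBasis rfl i 
  set μ := hsymm.eigenvalues rfl i
  have hv : v ≠ 0 := (hsymm.eigenvectorBasis rfl).orthonormal.ne_zero i
  have hAv : A v = (μ : ℂ) • v := hsymm.apply_eigenvectorBasis rfl i
  have hμ : μ ∈ Set.Ioo r R := by
    by_contra hμ
    obtain ⟨u, hu⟩ := hunit (μ : ℂ) fun ν hν h => hμ (Complex.ofReal_injective h ▸ hν)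
    have h0 : ((u⁻¹ : (E →L[ℂ] E)ˣ) : E →L[ℂ] E) ((u : E →L[ℂ] E) v) = v := by
      rw [← mul_apply_eq_comp, Units.inv_mul, one_apply_eq_self]
    refine hv (h0.symm.trans ?_)
    rw [hu]
    simp [hAv]
  have hcircv : ∀ (ρ θ : ℝ),
      (((ρ : ℂ) * Complex.exp (Complex.I * (θ : ℂ))) • (1 : E →L[ℂ] E) - A) v =
        ((ρ : ℂ) * Complex.exp (Complex.I * (θ : ℂ)) - μ) • v := by
    intro ρ θ
    simp [hAv, sub_smul]
  have hrayv : ∀ t : ℝ, ((t : ℂ) • (1 : E →L[ℂ] E) + A) v = ((t : ℂ) + μ) • v := by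
    intro t
    simp [hAv, add_smul]
  have hpow : ContinuousOn (fun t : ℝ => ((t ^ (-β) : ℝ) : ℂ)) (Set.uIcc r R) :=
    Complex.continuous_ofReal.comp_continuousOn fun t ht =>
      (Real.continuousAt_rpow_const t (-β) (Or.inl (hpos t ht).ne')).continuousWithinAt
  simp only [ContinuousLinearMap.coe_coe, sub_apply,
    add_apply, smul_apply]
  rw [hAnegβ μ v hAv, rpow_neg_eq_keyhole hr hμ.1 hμ.2 β,
    integral_smul_ringInverse_apply hpow (by fun_prop) hray hv hrayv,
    integral_smul_ringInverse_apply (by fun_prop) (by fun_prop)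
      (fun θ _ => hcirc R (hr.trans hrR) (fun h => lt_irrefl _ h.2) θ) hv (hcircv R),
    integral_smul_ringInverse_apply (by fun_prop) (by fun_prop)
      (fun θ _ => hcirc r hr (fun h => lt_irrefl _ h.1) θ) hv (hcircv r)]
  simp only [smul_smul, ← add_smul, ← sub_smul]
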